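/- arXiv:1807.07225 — 4 statements merged into one kernel-verified Lean document; each statement's English description precedes it below -/
import Mathlib

section
/- Let λ, μ ∈ ℝ and s > 0. Let Ω ⊂ ℝ² be an open set containing no point of the set {x ∈ ℝ² : x₂ = 0 and x₁ ≤ 0} (the nonpositive real axis under the identification z = x₁ + i·x₂). Then the function v : ℝ² → ℂ² defined by v(x) = (exp(−s√z), i·exp(−s√z)), with z = x₁ + i·x₂ and √z the principal complex square root, is smooth on Ω and satisfies the planar Lamé system 𝓛v = 0 pointwise at every point of Ω. -/
noncomputable section

open Complex MeasureTheory Set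

/-- Principal complex square root. -/
def csqrt (z : ℂ) : ℂ := z ^ (1/2 : ℂ)

/-- Partial derivative in the first real coordinate. -/
def pd1 (f : ℝ × ℝ → ℂ) (x : ℝ × ℝ) : ℂ := deriv (fun t => f (t, x.2)) x.1

/-- Partial derivative in the second real coordinate. -/
def pd2 (f : ℝ × ℝ → ℂ) (x : ℝ × ℝ) : ℂ := deriv (fun t => f (x.1, t)) x.2

/-- The planar Lamé operator 𝓛u = λΔu + (λ+μ)∇(∇·u). -/
def Lame (lam mu : ℝ) (u : ℝ × ℝ → ℂ × ℂ) (x : ℝ × ℝ) : ℂ × ℂ :=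
  ((lam : ℂ) * (pd1 (pd1 fun y => (u y).1) x + pd2 (pd2 fun y => (u y).1) x)
      + ((lam : ℂ) + (mu : ℂ)) * (pd1 (pd1 fun y => (u y).1) x + pd1 (pd2 fun y => (u y).2) x),
   (lam : ℂ) * (pd1 (pd1 fun y => (u y).2) x + pd2 (pd2 fun y => (u y).2) x)
      + ((lam : ℂ) + (mu : ℂ)) * (pd1 (pd2 fun y => (u y).1) x + pd2 (pd2 fun y => (u y).2) x))

/-- The exponential solution v(x) = (exp(−s√z), i exp(−s√z)), z = x₁ + i x₂. -/
def vfun (s : ℝ) (x : ℝ × ℝ) : ℂ × ℂ :=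
  (Complex.exp (-(s : ℂ) * csqrt (x.1 + x.2 * Complex.I)),
   Complex.I * Complex.exp (-(s : ℂ) * csqrt (x.1 + x.2 * Complex.I)))

def zmap (y : ℝ × ℝ) : ℂ := y.1 + y.2 * Complex.I

lemma zmap_smooth : ContDiff ℝ (⊤ : ℕ∞) zmap := by
  unfold zmap
  exact (Complex.ofRealCLM.contDiff.comp contDiff_fst).add
    ((Complex.ofRealCLM.contDiff.comp contDiff_snd).mul contDiff_const)

lemma pd1_aux (g : ℝ × ℝ → ℂ) (F : ℂ → ℂ) (c : ℂ) (x : ℝ × ℝ)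
    (hF : DifferentiableAt ℂ F (zmap x))
    (h : ∀ᶠ y in nhds x, g y = c * F (zmap y)) : pd1 g x = c * deriv F (zmap x) := by
  unfold pd1
  have hc : Filter.Tendsto (fun t : ℝ => (t, x.2)) (nhds x.1) (nhds x) := by
    have : Continuous (fun t : ℝ => (t, x.2)) := by fun_prop
    exact this.tendsto x.1
  have he : (fun t => g (t, x.2)) =ᶠ[nhds x.1] fun t => c * F (zmap (t, x.2)) :=
    hc.eventually h
  rw [he.deriv_eq]
  have hz : HasDerivAt (fun t : ℝ => zmap (t, x.2)) 1 x.1 := by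
    unfold zmap
    simpa using (Complex.ofRealCLM.hasDerivAt (x := x.1)).add_const ((x.2 : ℂ) * Complex.I)
  have := (HasDerivAt.scomp (𝕜 := ℝ) x.1 (h := fun t : ℝ => zmap (t, x.2)) hF.hasDerivAt hz).const_mul c
  simpa using this.deriv

lemma pd2_aux (g : ℝ × ℝ → ℂ) (F : ℂ → ℂ) (c : ℂ) (x : ℝ × ℝ)
    (hF : DifferentiableAt ℂ F (zmap x))
    (h : ∀ᶠ y in nhds x, g y = c * F (zmap y)) :
    pd2 g x = (c * Complex.I) * deriv F (zmap x) := by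
  unfold pd2
  have hc : Filter.Tendsto (fun t : ℝ => (x.1, t)) (nhds x.2) (nhds x) := by
    have : Continuous (fun t : ℝ => (x.1, t)) := by fun_prop
    exact this.tendsto x.2
  have he : (fun t => g (x.1, t)) =ᶠ[nhds x.2] fun t => c * F (zmap (x.1, t)) :=
    hc.eventually h
  rw [he.deriv_eq]
  have hz : HasDerivAt (fun t : ℝ => zmap (x.1, t)) Complex.I x.2 := by
    unfold zmap
    simpa using ((Complex.ofRealCLM.hasDerivAt (x := x.2)).mul_const Complex.I).const_add (x.1 : ℂ)
  have := (HasDerivAt.scomp (𝕜 := ℝ) x.2 (h := fun t : ℝ => zmap (x.1, t)) hF.hasDerivAt hz).const_mul c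
  rw [mul_assoc]
  simpa using this.deriv

def Ffun (s : ℝ) (z : ℂ) : ℂ := Complex.exp (-(s : ℂ) * csqrt z)

lemma Ffun_diff (s : ℝ) : DifferentiableOn ℂ (Ffun s) Complex.slitPlane := by
  intro z hz
  unfold Ffun csqrt
  have h : DifferentiableAt ℂ (fun z : ℂ => z ^ (1/2 : ℂ)) z :=
    differentiableAt_id.cpow_const hz
  exact ((h.const_mul _).cexp).differentiableWithinAt

theorem stmt_0 (lam mu s : ℝ) (hs : 0 < s) (Ω : Set (ℝ × ℝ)) (hΩ : IsOpen Ω)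
    (hcut : ∀ x ∈ Ω, ¬(x.2 = 0 ∧ x.1 ≤ 0)) :
    ContDiffOn ℝ (⊤ : ℕ∞) (vfun s) Ω ∧ ∀ x ∈ Ω, Lame lam mu (vfun s) x = 0 := by
  have hsl : ∀ x ∈ Ω, zmap x ∈ Complex.slitPlane := by
    intro x hx
    rw [Complex.mem_slitPlane_iff]
    have := hcut x hx
    simp only [zmap, Complex.add_re, Complex.ofReal_re, Complex.mul_re, Complex.I_re,
      Complex.ofReal_im, Complex.I_im, Complex.add_im, Complex.mul_im]
    by_cases h : x.2 = 0
    · left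
      have h2 : ¬ x.1 ≤ 0 := fun h' => this ⟨h, h'⟩
      push Not at h2
      simpa using h2
    · right
      simpa using h
  have hO := Complex.isOpen_slitPlane
  have hF := Ffun_diff s
  have hF' := hF.deriv hO
  refine ⟨?_, ?_⟩
  · have h1 : ContDiffOn ℝ (⊤ : ℕ∞) (fun x => Ffun s (zmap x)) Ω := by
      have h2 : ContDiffOn ℝ (⊤ : ℕ∞) (Ffun s) Complex.slitPlane :=
        (hF.contDiffOn hO).restrict_scalars ℝ
      exact h2.comp zmap_smooth.contDiffOn hsl
    exact h1.prodMk (contDiffOn_const.mul h1)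
  · intro x hx
    have key : ∀ y ∈ Ω, DifferentiableAt ℂ (Ffun s) (zmap y) := fun y hy =>
      hF.differentiableAt (hO.mem_nhds (hsl y hy))
    have key' := hF'.differentiableAt (hO.mem_nhds (hsl x hx))
    have hn : ∀ᶠ y in nhds x, y ∈ Ω := hΩ.mem_nhds hx
    have e1 : ∀ y, (vfun s y).1 = 1 * Ffun s (zmap y) := fun y => by simp [vfun, Ffun, zmap]
    have e2 : ∀ y, (vfun s y).2 = Complex.I * Ffun s (zmap y) := fun y => by
      simp [vfun, Ffun, zmap]
    have a1 := hn.mono fun y hy => pd1_aux (fun y => (vfun s y).1) _ _ y (key y hy) (.of_forall e1)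
    have a2 := hn.mono fun y hy => pd2_aux (fun y => (vfun s y).1) _ _ y (key y hy) (.of_forall e1)
    have b1 := hn.mono fun y hy => pd1_aux (fun y => (vfun s y).2) _ _ y (key y hy) (.of_forall e2)
    have b2 := hn.mono fun y hy => pd2_aux (fun y => (vfun s y).2) _ _ y (key y hy) (.of_forall e2)
    unfold Lame
    rw [pd1_aux _ _ _ x key' a1, pd2_aux _ _ _ x key' a2, pd1_aux _ _ _ x key' b1,
      pd2_aux _ _ _ x key' b2, pd1_aux _ _ _ x key' b2, pd1_aux _ _ _ x key' a2]
    have hI := Complex.I_mul_I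
    ext1
    · simp only [Prod.fst_zero]
      linear_combination (2 * (lam : ℂ) + mu) * deriv (deriv (Ffun s)) (zmap x) * hI
    · simp only [Prod.snd_zero]
      linear_combination (2 * (lam : ℂ) + mu) * Complex.I * deriv (deriv (Ffun s)) (zmap x) * hI
end
end

section
/- Let λ, μ ∈ ℝ, let U ⊂ ℂ be open, and let g : ℂ → ℂ be complex differentiable at every point of U. Define v : ℝ² → ℂ² by v(x) = (g(x₁ + i·x₂), i·g(x₁ + i·x₂)). Then v satisfies the planar Lamé system 𝓛v = 0 pointwise at every x ∈ ℝ² with x₁ + i·x₂ ∈ U. -/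
noncomputable section

open Complex Set

theorem pd_aux (U : Set ℂ) (hU : IsOpen U) (h : ℂ → ℂ)
    (hh : ∀ z ∈ U, DifferentiableAt ℂ h z) (F : ℝ × ℝ → ℂ)
    (hF : ∀ y : ℝ × ℝ, ((y.1 : ℂ) + y.2 * Complex.I) ∈ U → F y = h (y.1 + y.2 * Complex.I))
    (x : ℝ × ℝ) (hx : ((x.1 : ℂ) + x.2 * Complex.I) ∈ U) :
    pd1 F x = deriv h (x.1 + x.2 * Complex.I) ∧
    pd2 F x = Complex.I * deriv h (x.1 + x.2 * Complex.I) := by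
  have hd := (hh _ hx).hasDerivAt
  constructor
  · have h1 : HasDerivAt (fun t : ℝ => (t : ℂ) + x.2 * Complex.I) 1 x.1 :=
      (Complex.ofRealCLM.hasDerivAt (x := x.1)).add_const _
    have h2 := HasDerivAt.comp x.1 (h₂ := h) (h := fun t : ℝ => (t : ℂ) + x.2 * Complex.I) hd h1
    have he : (fun t : ℝ => F (t, x.2)) =ᶠ[nhds x.1]
        (h ∘ fun t : ℝ => (t : ℂ) + x.2 * Complex.I) := by
      filter_upwards [h1.continuousAt.preimage_mem_nhds (hU.mem_nhds hx)] with t ht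
      exact hF (t, x.2) ht
    unfold pd1
    rw [he.deriv_eq, h2.deriv, mul_one]
  · have h1 : HasDerivAt (fun t : ℝ => (x.1 : ℂ) + t * Complex.I) (1 * Complex.I) x.2 :=
      ((Complex.ofRealCLM.hasDerivAt (x := x.2)).mul_const _).const_add _
    have h2 := HasDerivAt.comp x.2 (h₂ := h) (h := fun t : ℝ => (x.1 : ℂ) + t * Complex.I) hd h1
    have he : (fun t : ℝ => F (x.1, t)) =ᶠ[nhds x.2]
        (h ∘ fun t : ℝ => (x.1 : ℂ) + t * Complex.I) := by
      filter_upwards [h1.continuousAt.preimage_mem_nhds (hU.mem_nhds hx)] with t ht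
      exact hF (x.1, t) ht
    unfold pd2
    rw [he.deriv_eq, h2.deriv]
    ring

theorem stmt_1 (lam mu : ℝ) (U : Set ℂ) (hU : IsOpen U) (g : ℂ → ℂ)
    (hg : ∀ z ∈ U, DifferentiableAt ℂ g z) :
    ∀ x : ℝ × ℝ, (x.1 + x.2 * Complex.I) ∈ U →
      Lame lam mu (fun y => (g (y.1 + y.2 * Complex.I),
        Complex.I * g (y.1 + y.2 * Complex.I))) x = 0 := by
  intro x hx
  have hg' : ∀ z ∈ U, DifferentiableAt ℂ (deriv g) z := fun z hz =>
    (DifferentiableOn.deriv (fun w hw => (hg w hw).differentiableWithinAt) hU).differentiableAt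
      (hU.mem_nhds hz)
  have hc : ∀ c : ℂ, ∀ z ∈ U, DifferentiableAt ℂ (fun w => c * g w) z :=
    fun c z hz => (hg z hz).const_mul c
  have hc' : ∀ c : ℂ, ∀ z ∈ U, DifferentiableAt ℂ (fun w => c * deriv g w) z :=
    fun c z hz => (hg' z hz).const_mul c
  have dc : ∀ c : ℂ, ∀ z ∈ U, deriv (fun w => c * g w) z = c * deriv g z :=
    fun c z hz => deriv_const_mul c (hg z hz)
  have dc' : ∀ c : ℂ, ∀ z ∈ U, deriv (fun w => c * deriv g w) z = c * deriv (deriv g) z :=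
    fun c z hz => deriv_const_mul c (hg' z hz)
  have key : ∀ (c : ℂ) (F : ℝ × ℝ → ℂ), (∀ y, F y = c * g (y.1 + y.2 * Complex.I)) →
      pd1 (pd1 F) x = c * deriv (deriv g) (x.1 + x.2 * Complex.I) ∧
      pd1 (pd2 F) x = Complex.I * c * deriv (deriv g) (x.1 + x.2 * Complex.I) ∧
      pd2 (pd2 F) x = - c * deriv (deriv g) (x.1 + x.2 * Complex.I) := by
    intro c F hF
    have A := pd_aux U hU _ (hc c) F (fun y _ => hF y)
    have B1 := pd_aux U hU _ (hc' c) (pd1 F) (fun y hy => by rw [(A y hy).1, dc c _ hy]) x hx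
    have B2 := pd_aux U hU _ (hc' (Complex.I * c)) (pd2 F)
      (fun y hy => by rw [(A y hy).2, dc c _ hy, mul_assoc]) x hx
    rw [dc' _ _ hx] at B1 B2
    refine ⟨B1.1, B2.1, ?_⟩
    rw [B2.2, ← mul_assoc, ← mul_assoc, Complex.I_mul_I]
    ring
  obtain ⟨a1, a2, a3⟩ := key 1 (fun y => g (y.1 + y.2 * Complex.I)) (fun y => by simp)
  obtain ⟨b1, b2, b3⟩ := key Complex.I (fun y => Complex.I * g (y.1 + y.2 * Complex.I))
    (fun y => rfl)
  unfold Lame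
  simp only [a1, a2, a3, b1, b2, b3, Complex.I_mul_I]
  ext1
  · simp only [Prod.fst_zero]; ring
  · simp only [Prod.snd_zero]; ring
end
end

section
/- Let −π < θ_m < θ_M < π and s > 0, and let K be the open planar sector with angles θ_m, θ_M. Then the function x ↦ exp(−s√(x₁ + i·x₂)) (principal square root) is Lebesgue integrable on K, and ∫_K exp(−s√(x₁ + i·x₂)) dx = 6i·(e^{−2iθ_M} − e^{−2iθ_m})·s^{−4}. -/
noncomputable section

open Complex MeasureTheory Real Set

/-- The open planar sector with angles `θm < arg z < θM`. -/
def sector (θm θM : ℝ) : Set (ℝ × ℝ) :=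
  {x | (x.1 + x.2 * Complex.I) ≠ 0 ∧ θm < (x.1 + x.2 * Complex.I).arg ∧
        (x.1 + x.2 * Complex.I).arg < θM}

lemma csqrt_polar (r θ : ℝ) (hr : 0 < r) (h : θ ∈ Ioc (-π) π) :
    csqrt (((r * Real.cos θ : ℝ) : ℂ) + ((r * Real.sin θ : ℝ) : ℂ) * Complex.I)
      = (r ^ (1/2:ℝ) : ℝ) * Complex.exp ((θ / 2 : ℝ) * Complex.I) := by
  have e : ((r * Real.cos θ : ℝ) : ℂ) + ((r * Real.sin θ : ℝ) : ℂ) * Complex.I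
      = (r : ℂ) * (Complex.cos θ + Complex.sin θ * Complex.I) := by push_cast; ring
  have ha := Complex.arg_mul_cos_add_sin_mul_I hr h
  have hr' : (r : ℂ) ≠ 0 := by exact_mod_cast hr.ne'
  rw [e, csqrt]
  have hn : ‖(r : ℂ) * (Complex.cos θ + Complex.sin θ * Complex.I)‖ = r := by
    rw [← Complex.exp_mul_I, norm_mul, Complex.norm_exp_ofReal_mul_I]; simp [hr.le]
  rw [Complex.cpow_def_of_ne_zero (by rw [← norm_pos_iff, hn]; exact hr), Complex.log, ha, hn,
    Real.rpow_def_of_pos hr, Complex.ofReal_exp, ← Complex.exp_add]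
  congr 1; push_cast; ring

lemma sector_eq (θm θM : ℝ) (h1 : -π < θm) (h3 : θM < π) :
    sector θm θM = polarCoord.symm '' (Ioi (0:ℝ) ×ˢ Ioo θm θM) := by
  ext x
  simp only [sector, mem_ofPred_eq, mem_image, mem_prod, mem_Ioi, mem_Ioo, polarCoord_symm_apply]
  constructor
  · rintro ⟨h0, ha, hb⟩
    refine ⟨(‖(x.1 + x.2 * Complex.I : ℂ)‖, (x.1 + x.2 * Complex.I : ℂ).arg), ⟨by simpa using h0, ha, hb⟩, ?_⟩
    ext
    · simp [Complex.norm_mul_cos_arg]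
    · simp [Complex.norm_mul_sin_arg]
  · rintro ⟨⟨r, θ⟩, ⟨hr, ha, hb⟩, rfl⟩
    dsimp only at *
    have e : ((r * Real.cos θ : ℝ) : ℂ) + ((r * Real.sin θ : ℝ) : ℂ) * Complex.I
      = (r : ℂ) * (Complex.cos θ + Complex.sin θ * Complex.I) := by push_cast; ring
    have hr' : (r : ℂ) ≠ 0 := by exact_mod_cast hr.ne'
    rw [e, Complex.arg_mul_cos_add_sin_mul_I hr ⟨by linarith, by linarith⟩]
    refine ⟨mul_ne_zero hr' ?_, ha, hb⟩
    rw [← Complex.exp_mul_I]; exact Complex.exp_ne_zero _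

lemma tendsto_aux (b : ℂ) (hb : 0 < b.re) (n : ℕ) :
    Filter.Tendsto (fun t : ℝ => (t:ℂ) ^ n * Complex.exp (-b * t)) Filter.atTop (nhds 0) := by
  rw [tendsto_zero_iff_norm_tendsto_zero]
  refine (tendsto_rpow_mul_exp_neg_mul_atTop_nhds_zero n b.re hb).congr' ?_
  filter_upwards [Filter.eventually_gt_atTop 0] with t ht
  rw [norm_mul, norm_pow, Complex.norm_exp, Complex.norm_real, Real.norm_of_nonneg ht.le,
    Real.rpow_natCast, Complex.re_mul_ofReal, Complex.neg_re]

lemma cubic (b : ℂ) (hb : 0 < b.re) :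
    ∫ t in Ioi (0:ℝ), (t:ℂ) ^ 3 * Complex.exp (-b * t) = 6 / b ^ 4 := by
  have hb0 : b ≠ 0 := by rintro rfl; simp at hb
  have hd : ∀ t ∈ Ici (0:ℝ), HasDerivAt (fun t : ℝ => -1 / b * ((t:ℂ) ^ 3 * Complex.exp (-b * t))
      + -3 / b ^ 2 * ((t:ℂ) ^ 2 * Complex.exp (-b * t))
      + -6 / b ^ 3 * ((t:ℂ) ^ 1 * Complex.exp (-b * t))
      + -6 / b ^ 4 * ((t:ℂ) ^ 0 * Complex.exp (-b * t))) ((t:ℂ) ^ 3 * Complex.exp (-b * t)) t := by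
    intro t _
    have he : HasDerivAt (fun z : ℂ => Complex.exp (-b * z)) (Complex.exp (-b * t) * (-b * 1)) t :=
      ((hasDerivAt_id (t:ℂ)).const_mul (-b)).cexp
    have hp : ∀ n : ℕ, HasDerivAt (fun z : ℂ => z ^ n * Complex.exp (-b * z)) _ (t:ℂ) :=
      fun n => (hasDerivAt_pow n (t:ℂ)).mul he
    have := (((((hp 3).const_mul (-1 / b)).add ((hp 2).const_mul (-3 / b ^ 2))).add
      ((hp 1).const_mul (-6 / b ^ 3))).add ((hp 0).const_mul (-6 / b ^ 4))).comp_ofReal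
    refine this.congr_deriv ?_
    norm_num
    field_simp
    ring
  have hint : IntegrableOn (fun t : ℝ => (t:ℂ) ^ 3 * Complex.exp (-b * t)) (Ioi 0) := by
    have g1 := integrableOn_rpow_mul_exp_neg_mul_rpow (s := 3) (p := 1) (by norm_num)
      (by norm_num) hb
    refine Integrable.mono' g1 (Measurable.aestronglyMeasurable (by fun_prop)) ?_
    refine (ae_restrict_iff' measurableSet_Ioi).2 (.of_forall fun t ht => ?_)
    have ht' : 0 < t := ht
    rw [norm_mul, norm_pow, Complex.norm_exp, Complex.norm_real, Real.norm_of_nonneg ht'.le,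
      Real.rpow_one, Complex.re_mul_ofReal, Complex.neg_re]
    norm_cast
  have ht := ((((tendsto_aux b hb 3).const_mul (-1 / b)).add
    ((tendsto_aux b hb 2).const_mul (-3 / b ^ 2))).add
    ((tendsto_aux b hb 1).const_mul (-6 / b ^ 3))).add
    ((tendsto_aux b hb 0).const_mul (-6 / b ^ 4))
  rw [integral_Ioi_of_hasDerivAt_of_tendsto' hd hint ht]
  simp
  ring

lemma radial (b : ℂ) (hb : 0 < b.re) :
    ∫ r in Ioi (0:ℝ), (r:ℂ) * Complex.exp (-b * (r ^ (1/2:ℝ) : ℝ)) = 12 / b ^ 4 := by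
  rw [← integral_comp_rpow_Ioi _ (two_ne_zero (α := ℝ))]
  rw [show (12:ℂ) / b ^ 4 = 2 * (6 / b ^ 4) by ring, ← cubic b hb, ← integral_const_mul]
  refine setIntegral_congr_fun measurableSet_Ioi fun t ht => ?_
  have ht' : 0 < t := ht
  have e1 : (t ^ (2:ℝ)) ^ (1/2:ℝ) = t := by
    rw [← Real.rpow_mul ht'.le]; norm_num
  simp only [e1, Complex.real_smul]
  norm_num
  ring

lemma integrable_T (θm θM s : ℝ) (h1 : -π < θm) (h2 : θm < θM) (h3 : θM < π) (hs : 0 < s) :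
    IntegrableOn (fun p : ℝ × ℝ => (p.1 : ℂ) * Complex.exp (-((s:ℂ) *
      Complex.exp ((p.2 / 2 : ℝ) * Complex.I)) * (p.1 ^ (1/2:ℝ) : ℝ)))
      (Ioi (0:ℝ) ×ˢ Ioo θm θM) (volume.prod volume) := by
  set m := max |θm| |θM| with hm
  have hmpi : m < π := max_lt (abs_lt.2 ⟨h1, by linarith⟩) (abs_lt.2 ⟨by linarith, h3⟩)
  have hm0 : 0 ≤ m := (abs_nonneg _).trans (le_max_left _ _)
  have hc : 0 < Real.cos (m / 2) := Real.cos_pos_of_mem_Ioo ⟨by linarith, by linarith⟩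
  have g1 := integrableOn_rpow_mul_exp_neg_mul_rpow (s := 1) (p := 1/2) (by norm_num)
    (by norm_num) (mul_pos hs hc)
  have g2 : IntegrableOn (fun _ : ℝ => (1:ℝ)) (Ioo θm θM) := by simp
  have g := Integrable.mul_prod g1 g2
  rw [Measure.prod_restrict] at g
  refine Integrable.mono' g ?_ ?_
  · refine Measurable.aestronglyMeasurable ?_
    fun_prop
  · refine (ae_restrict_iff' (measurableSet_Ioi.prod measurableSet_Ioo)).2 (.of_forall ?_)
    rintro ⟨r, θ⟩ ⟨hr, ha, hb⟩
    dsimp only at *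
    have hr' : 0 < r := hr
    have hθ : |θ| ≤ m := abs_le_max_abs_abs ha.le hb.le
    have hcos : Real.cos (m/2) ≤ Real.cos (θ/2) := by
      rw [← Real.cos_abs (θ/2), abs_div, abs_two]
      exact Real.cos_le_cos_of_nonneg_of_le_pi (by positivity) (by linarith) (by linarith)
    rw [norm_mul, Complex.norm_exp, mul_one, Real.rpow_one, Complex.norm_real, Real.norm_of_nonneg hr'.le]
    have : (-((s:ℂ) * Complex.exp ((θ / 2 : ℝ) * Complex.I)) * (r ^ (1/2:ℝ) : ℝ)).re
        = -(s * Real.cos (θ/2)) * r ^ (1/2:ℝ) := by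
      rw [Complex.re_mul_ofReal, Complex.neg_re, Complex.re_ofReal_mul, Complex.exp_ofReal_mul_I_re]
    rw [this]
    have := Real.rpow_nonneg hr'.le (1/2)
    gcongr

theorem stmt_4 (θm θM s : ℝ) (h1 : -π < θm) (h2 : θm < θM) (h3 : θM < π) (hs : 0 < s) :
    IntegrableOn (fun x : ℝ × ℝ => Complex.exp (-(s : ℂ) * csqrt (x.1 + x.2 * Complex.I)))
        (sector θm θM) volume ∧
      ∫ x in sector θm θM, Complex.exp (-(s : ℂ) * csqrt (x.1 + x.2 * Complex.I))
        = 6 * Complex.I *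
            (Complex.exp (-2 * (θM : ℂ) * Complex.I) - Complex.exp (-2 * (θm : ℂ) * Complex.I))
            / (s : ℂ) ^ 4 := by
  have hT : MeasurableSet (Ioi (0:ℝ) ×ˢ Ioo θm θM) := measurableSet_Ioi.prod measurableSet_Ioo
  have hinj : InjOn polarCoord.symm (Ioi (0:ℝ) ×ˢ Ioo θm θM) :=
    polarCoord.symm.injOn.mono (prod_mono le_rfl (Ioo_subset_Ioo h1.le h3.le))
  have hder := fun (p : ℝ × ℝ) (_ : p ∈ Ioi (0:ℝ) ×ˢ Ioo θm θM) =>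
    (hasFDerivAt_polarCoord_symm p).hasFDerivWithinAt (s := Ioi (0:ℝ) ×ˢ Ioo θm θM)
  have hI := integrable_T θm θM s h1 h2 h3 hs
  have hcongr : EqOn (fun p : ℝ × ℝ => |(fderivPolarCoordSymm p).det| •
      (fun x : ℝ × ℝ => Complex.exp (-(s : ℂ) * csqrt (x.1 + x.2 * Complex.I))) (polarCoord.symm p))
      (fun p : ℝ × ℝ => (p.1 : ℂ) * Complex.exp (-((s:ℂ) *
      Complex.exp ((p.2 / 2 : ℝ) * Complex.I)) * (p.1 ^ (1/2:ℝ) : ℝ)))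
      (Ioi (0:ℝ) ×ˢ Ioo θm θM) := by
    rintro ⟨r, θ⟩ ⟨hr, ha, hb⟩
    dsimp only at ha hb
    have hr' : 0 < r := hr
    simp only [det_fderivPolarCoordSymm, polarCoord_symm_apply]
    rw [csqrt_polar r θ hr' ⟨by linarith, by linarith⟩, abs_of_pos hr', Complex.real_smul]
    congr 2; ring
  rw [sector_eq θm θM h1 h3]
  constructor
  · rw [integrableOn_image_iff_integrableOn_abs_det_fderiv_smul volume hT hder hinj]
    exact hI.congr_fun hcongr.symm hT
  · rw [integral_image_eq_integral_abs_det_fderiv_smul volume hT hder hinj,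
      setIntegral_congr_fun hT hcongr, Measure.volume_eq_prod, ← setIntegral_prod_swap,
      setIntegral_prod (fun z : ℝ × ℝ => ((z.swap.1 : ℝ) : ℂ) * Complex.exp (-((s:ℂ) *
      Complex.exp ((z.swap.2 / 2 : ℝ) * Complex.I)) * (z.swap.1 ^ (1/2:ℝ) : ℝ))) hI.swap]
    have hs' : (s:ℂ) ≠ 0 := by exact_mod_cast hs.ne'
    have : ∀ θ ∈ Ioo θm θM, ∫ r in Ioi (0:ℝ), (r : ℂ) * Complex.exp (-((s:ℂ) *
      Complex.exp ((θ / 2 : ℝ) * Complex.I)) * (r ^ (1/2:ℝ) : ℝ)) =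
        12 / (s:ℂ)^4 * Complex.exp ((-2 * Complex.I) * θ) := by
      intro θ hθ
      rw [radial]
      · rw [mul_pow, ← Complex.exp_nat_mul, div_mul_eq_div_div, div_eq_mul_inv _ (Complex.exp _),
          ← Complex.exp_neg]
        congr 2; push_cast; ring
      · rw [Complex.re_ofReal_mul, Complex.exp_ofReal_mul_I_re]
        exact mul_pos hs (Real.cos_pos_of_mem_Ioo ⟨by linarith [hθ.1], by linarith [hθ.2]⟩)
    simp only [Prod.swap]
    rw [setIntegral_congr_fun measurableSet_Ioo this, integral_const_mul, ← integral_Ioc_eq_integral_Ioo,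
      ← intervalIntegral.integral_of_le h2.le, integral_exp_mul_complex (by simp)]
    rw [show -2 * Complex.I * (θM:ℂ) = -2 * θM * Complex.I by ring,
      show -2 * Complex.I * (θm:ℂ) = -2 * θm * Complex.I by ring]
    have hI2 : Complex.I ≠ 0 := Complex.I_ne_zero
    field_simp
    rw [Complex.I_sq]; ring
end
end

section
/- Let λ, μ ∈ ℝ, L > 0, let D ⊂ ℝ² be open, let u : ℝ³ → ℂ³ be twice continuously differentiable on an open set containing D × [−L, L], let φ : ℝ → ℝ be smooth with compact support contained in (−L, L), and let ξ ∈ ℝ. Define the dimension reduction operator R_ξ g(x') = ∫_{−L}^{L} e^{−i x₃ ξ} φ(x₃) g(x', x₃) dx₃. Then for every x' ∈ D one has 𝓛̃(R_ξ u)(x') = R_ξ(𝓛u)(x') + I_ξ(x') + II_ξ(x'), where, with M = diag(λ, λ, 2λ+μ) and w = (∂₁u₃, ∂₂u₃, ∂₁u₁ + ∂₂u₂): I_ξ(x') = −∫_{−L}^{L} e^{−i x₃ ξ} φ''(x₃)(Mu)(x',x₃) dx₃ + 2iξ∫_{−L}^{L} e^{−i x₃ ξ} φ'(x₃)(Mu)(x',x₃)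 dx₃ + ξ²·R_ξ(Mu)(x') and II_ξ(x') = −iξ(λ+μ)·R_ξ(w)(x') + (λ+μ)∫_{−L}^{L} e^{−i x₃ ξ} φ'(x₃) w(x',x₃) dx₃. -/
noncomputable section

open Complex MeasureTheory Set intervalIntegral

/-- Partial derivatives of `f : ℝ³ → ℂ` with `ℝ³ = (ℝ × ℝ) × ℝ`, `x = (x', x₃)`. -/
def qd1 (f : (ℝ × ℝ) × ℝ → ℂ) (x : (ℝ × ℝ) × ℝ) : ℂ :=
  deriv (fun t => f ((t, x.1.2), x.2)) x.1.1

def qd2 (f : (ℝ × ℝ) × ℝ → ℂ) (x : (ℝ × ℝ) × ℝ) : ℂ :=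
  deriv (fun t => f ((x.1.1, t), x.2)) x.1.2

def qd3 (f : (ℝ × ℝ) × ℝ → ℂ) (x : (ℝ × ℝ) × ℝ) : ℂ :=
  deriv (fun t => f (x.1, t)) x.2

/-- The divergence `∇·u` of `u : ℝ³ → ℂ³`. -/
def div3 (u : (ℝ × ℝ) × ℝ → ℂ × ℂ × ℂ) (x : (ℝ × ℝ) × ℝ) : ℂ :=
  qd1 (fun y => (u y).1) x + qd2 (fun y => (u y).2.1) x + qd3 (fun y => (u y).2.2) x

/-- The 3D Lamé operator `𝓛u = λΔu + (λ+μ)∇(∇·u)`. -/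
def Lame3 (lam mu : ℝ) (u : (ℝ × ℝ) × ℝ → ℂ × ℂ × ℂ) (x : (ℝ × ℝ) × ℝ) : ℂ × ℂ × ℂ :=
  ((lam : ℂ) * (qd1 (qd1 fun y => (u y).1) x + qd2 (qd2 fun y => (u y).1) x
        + qd3 (qd3 fun y => (u y).1) x) + ((lam : ℂ) + (mu : ℂ)) * qd1 (div3 u) x,
   (lam : ℂ) * (qd1 (qd1 fun y => (u y).2.1) x + qd2 (qd2 fun y => (u y).2.1) x
        + qd3 (qd3 fun y => (u y).2.1) x) + ((lam : ℂ) + (mu : ℂ)) * qd2 (div3 u) x,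
   (lam : ℂ) * (qd1 (qd1 fun y => (u y).2.2) x + qd2 (qd2 fun y => (u y).2.2) x
        + qd3 (qd3 fun y => (u y).2.2) x) + ((lam : ℂ) + (mu : ℂ)) * qd3 (div3 u) x)

/-- The reduced Lamé operator `𝓛̃` acting on `U : ℝ² → ℂ³`. -/
def LameRed (lam mu : ℝ) (U : ℝ × ℝ → ℂ × ℂ × ℂ) (x : ℝ × ℝ) : ℂ × ℂ × ℂ :=
  ((lam : ℂ) * (pd1 (pd1 fun y => (U y).1) x + pd2 (pd2 fun y => (U y).1) x)
      + ((lam : ℂ) + (mu : ℂ)) * (pd1 (pd1 fun y => (U y).1) x + pd1 (pd2 fun y => (U y).2.1) x),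
   (lam : ℂ) * (pd1 (pd1 fun y => (U y).2.1) x + pd2 (pd2 fun y => (U y).2.1) x)
      + ((lam : ℂ) + (mu : ℂ)) * (pd1 (pd2 fun y => (U y).1) x + pd2 (pd2 fun y => (U y).2.1) x),
   (lam : ℂ) * (pd1 (pd1 fun y => (U y).2.2) x + pd2 (pd2 fun y => (U y).2.2) x))

/-- The dimension reduction operator `R_ξ g (x') = ∫_{-L}^{L} e^{-i x₃ ξ} φ(x₃) g(x', x₃) dx₃`. -/
def Rxi (L ξ : ℝ) (φ : ℝ → ℝ) (g : (ℝ × ℝ) × ℝ → ℂ × ℂ × ℂ) (x' : ℝ × ℝ) : ℂ × ℂ × ℂ :=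
  ∫ t in (-L)..L, (Complex.exp (-Complex.I * (t : ℂ) * (ξ : ℂ)) * (φ t : ℂ)) • g (x', t)

/-- The multiplier `M = diag(λ, λ, 2λ+μ)` applied to `u`. -/
def Mop (lam mu : ℝ) (u : (ℝ × ℝ) × ℝ → ℂ × ℂ × ℂ) (x : (ℝ × ℝ) × ℝ) : ℂ × ℂ × ℂ :=
  ((lam : ℂ) * (u x).1, (lam : ℂ) * (u x).2.1, ((2 * lam + mu : ℝ) : ℂ) * (u x).2.2)

/-- `w = (∂₁u₃, ∂₂u₃, ∂₁u₁ + ∂₂u₂)`. -/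
def wop (u : (ℝ × ℝ) × ℝ → ℂ × ℂ × ℂ) (x : (ℝ × ℝ) × ℝ) : ℂ × ℂ × ℂ :=
  (qd1 (fun y => (u y).2.2) x, qd2 (fun y => (u y).2.2) x,
   qd1 (fun y => (u y).1) x + qd2 (fun y => (u y).2.1) x)


lemma aux_has1 {f : (ℝ × ℝ) × ℝ → ℂ} {O : Set ((ℝ × ℝ) × ℝ)} (hO : IsOpen O)
    (hf : ContDiffOn ℝ 1 f O) {x : (ℝ × ℝ) × ℝ} (hx : x ∈ O) :
    HasDerivAt (fun t => f ((t, x.1.2), x.2)) (fderiv ℝ f x ((1, 0), 0)) x.1.1 := by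
  have h := ((hf.contDiffAt (hO.mem_nhds hx)).differentiableAt (by norm_num)).hasFDerivAt
  have hc : HasDerivAt (fun t : ℝ => ((t, x.1.2), x.2)) ((1, 0), 0) x.1.1 :=
    ((hasDerivAt_id _).prodMk (hasDerivAt_const _ _)).prodMk (hasDerivAt_const _ _)
  exact HasFDerivAt.comp_hasDerivAt x.1.1 h hc

lemma aux_has2 {f : (ℝ × ℝ) × ℝ → ℂ} {O : Set ((ℝ × ℝ) × ℝ)} (hO : IsOpen O)
    (hf : ContDiffOn ℝ 1 f O) {x : (ℝ × ℝ) × ℝ} (hx : x ∈ O) :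
    HasDerivAt (fun t => f ((x.1.1, t), x.2)) (fderiv ℝ f x ((0, 1), 0)) x.1.2 := by
  have h := ((hf.contDiffAt (hO.mem_nhds hx)).differentiableAt (by norm_num)).hasFDerivAt
  have hc : HasDerivAt (fun t : ℝ => ((x.1.1, t), x.2)) ((0, 1), 0) x.1.2 :=
    ((hasDerivAt_const _ _).prodMk (hasDerivAt_id _)).prodMk (hasDerivAt_const _ _)
  exact HasFDerivAt.comp_hasDerivAt x.1.2 h hc

lemma aux_has3 {f : (ℝ × ℝ) × ℝ → ℂ} {O : Set ((ℝ × ℝ) × ℝ)} (hO : IsOpen O)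
    (hf : ContDiffOn ℝ 1 f O) {x : (ℝ × ℝ) × ℝ} (hx : x ∈ O) :
    HasDerivAt (fun t => f (x.1, t)) (fderiv ℝ f x ((0, 0), 1)) x.2 := by
  have h := ((hf.contDiffAt (hO.mem_nhds hx)).differentiableAt (by norm_num)).hasFDerivAt
  have hc : HasDerivAt (fun t : ℝ => (x.1, t)) ((0, 0), 1) x.2 :=
    (hasDerivAt_const _ _).prodMk (hasDerivAt_id _)
  exact HasFDerivAt.comp_hasDerivAt x.2 h hc

/-- `Q` acts on `C¹` functions on `O` as the directional derivative along `v`. -/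
def IsDir (O : Set ((ℝ × ℝ) × ℝ)) (Q : ((ℝ × ℝ) × ℝ → ℂ) → (ℝ × ℝ) × ℝ → ℂ)
    (v : (ℝ × ℝ) × ℝ) : Prop :=
  ∀ f, ContDiffOn ℝ 1 f O → ∀ x ∈ O, Q f x = fderiv ℝ f x v

lemma isDir1 {O} (hO : IsOpen O) : IsDir O qd1 ((1, 0), 0) :=
  fun _ hf _ hx => (aux_has1 hO hf hx).deriv
lemma isDir2 {O} (hO : IsOpen O) : IsDir O qd2 ((0, 1), 0) :=
  fun _ hf _ hx => (aux_has2 hO hf hx).deriv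
lemma isDir3 {O} (hO : IsOpen O) : IsDir O qd3 ((0, 0), 1) :=
  fun _ hf _ hx => (aux_has3 hO hf hx).deriv

lemma IsDir.smooth1 {O Q v} (hO : IsOpen O) (hQ : IsDir O Q v) {f : (ℝ × ℝ) × ℝ → ℂ}
    (hf : ContDiffOn ℝ 2 f O) : ContDiffOn ℝ 1 (Q f) O := by
  have h1 : ContDiffOn ℝ 1 f O := hf.of_le (by norm_num)
  have h2 : ContDiffOn ℝ 1 (fderiv ℝ f) O := hf.fderiv_of_isOpen hO (by norm_num)
  exact (h2.clm_apply contDiffOn_const).congr fun x hx => hQ f h1 x hx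

lemma IsDir.cont {O Q v} (hO : IsOpen O) (hQ : IsDir O Q v) {f : (ℝ × ℝ) × ℝ → ℂ}
    (hf : ContDiffOn ℝ 1 f O) : ContinuousOn (Q f) O := by
  have h2 : ContDiffOn ℝ 0 (fderiv ℝ f) O := hf.fderiv_of_isOpen hO (by norm_num)
  exact (h2.continuousOn.clm_apply continuousOn_const).congr fun x hx => hQ f hf x hx

lemma IsDir.second {O Q v Q' v'} (hO : IsOpen O) (hQ : IsDir O Q v) (hQ' : IsDir O Q' v')
    {f : (ℝ × ℝ) × ℝ → ℂ} (hf : ContDiffOn ℝ 2 f O) {x} (hx : x ∈ O) :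
    Q (Q' f) x = fderiv ℝ (fderiv ℝ f) x v v' := by
  have h1 : ContDiffOn ℝ 1 f O := hf.of_le (by norm_num)
  have h2 : ContDiffOn ℝ 1 (fderiv ℝ f) O := hf.fderiv_of_isOpen hO (by norm_num)
  rw [hQ _ (hQ'.smooth1 hO hf) x hx]
  have he : Q' f =ᶠ[nhds x] fun y => fderiv ℝ f y v' := by
    filter_upwards [hO.mem_nhds hx] with y hy using hQ' f h1 y hy
  rw [he.fderiv_eq]
  have hd := (h2.contDiffAt (hO.mem_nhds hx)).differentiableAt (by norm_num)
  rw [fderiv_clm_apply hd (differentiableAt_const _)]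
  simp

lemma IsDir.symm {O Q v Q' v'} (hO : IsOpen O) (hQ : IsDir O Q v) (hQ' : IsDir O Q' v')
    {f : (ℝ × ℝ) × ℝ → ℂ} (hf : ContDiffOn ℝ 2 f O) {x} (hx : x ∈ O) :
    Q (Q' f) x = Q' (Q f) x := by
  rw [hQ.second hO hQ' hf hx, hQ'.second hO hQ hf hx]
  exact (hf.contDiffAt (hO.mem_nhds hx)).isSymmSndFDerivAt (by simp) v v'

lemma IsDir.add {O Q v} (hO : IsOpen O) (hQ : IsDir O Q v) {f g : (ℝ × ℝ) × ℝ → ℂ}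
    (hf : ContDiffOn ℝ 1 f O) (hg : ContDiffOn ℝ 1 g O) {x} (hx : x ∈ O) :
    Q (fun y => f y + g y) x = Q f x + Q g x := by
  rw [hQ _ (hf.add hg) x hx, hQ _ hf x hx, hQ _ hg x hx]
  have e1 := (hf.contDiffAt (hO.mem_nhds hx)).differentiableAt (by norm_num)
  have e2 := (hg.contDiffAt (hO.mem_nhds hx)).differentiableAt (by norm_num)
  rw [fderiv_fun_add e1 e2]
  rfl

/-- Scalar reduction with a general weight. -/
def Sc (L : ℝ) (ψ : ℝ → ℂ) (f : (ℝ × ℝ) × ℝ → ℂ) (x' : ℝ × ℝ) : ℂ :=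
  ∫ t in (-L)..L, ψ t * f (x', t)

lemma slice_cont {E : Type*} [TopologicalSpace E] {L : ℝ} {D : Set (ℝ × ℝ)}
    {O : Set ((ℝ × ℝ) × ℝ)}
    (hsub : D ×ˢ Set.Icc (-L) L ⊆ O) {f : (ℝ × ℝ) × ℝ → E} (hf : ContinuousOn f O)
    {x' : ℝ × ℝ} (hx : x' ∈ D) : ContinuousOn (fun t => f (x', t)) (Set.Icc (-L) L) :=
  hf.comp (by fun_prop) fun t ht => hsub ⟨hx, ht⟩

lemma Sc_int {L : ℝ} (hL : 0 < L) {D : Set (ℝ × ℝ)} {O : Set ((ℝ × ℝ) × ℝ)}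
    (hsub : D ×ˢ Set.Icc (-L) L ⊆ O) {ψ : ℝ → ℂ} (hψ : Continuous ψ)
    {f : (ℝ × ℝ) × ℝ → ℂ} (hf : ContinuousOn f O)
    {x' : ℝ × ℝ} (hx : x' ∈ D) :
    IntervalIntegrable (fun t => ψ t * f (x', t)) volume (-L) L := by
  apply ContinuousOn.intervalIntegrable
  rw [Set.uIcc_of_le (by linarith)]
  exact hψ.continuousOn.mul (slice_cont hsub hf hx)

lemma Sc_diff {L : ℝ} (hL : 0 < L) {D : Set (ℝ × ℝ)} (hD : IsOpen D) {O : Set ((ℝ × ℝ) × ℝ)}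
    (hsub : D ×ˢ Set.Icc (-L) L ⊆ O) {ψ : ℝ → ℂ} (hψ : Continuous ψ)
    {f g : (ℝ × ℝ) × ℝ → ℂ} (hf : ContinuousOn f O) (hg : ContinuousOn g O)
    {c : ℝ → ℝ × ℝ} (hc : Continuous c) {s₀ : ℝ} (hs₀ : c s₀ ∈ D)
    (hd : ∀ s t, (c s, t) ∈ O → HasDerivAt (fun s => f (c s, t)) (g (c s, t)) s) :
    HasDerivAt (fun s => Sc L ψ f (c s)) (Sc L ψ g (c s₀)) s₀ := by
  have hle : -L ≤ L := by linarith
  have hpre : IsOpen (c ⁻¹' D) := hD.preimage hc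
  obtain ⟨K, hK, hKn, hKD⟩ := exists_compact_subset hpre hs₀
  have hcont : ContinuousOn (fun p : ℝ × ℝ => ψ p.2 * g (c p.1, p.2)) (K ×ˢ Set.Icc (-L) L) := by
    apply ContinuousOn.mul (by fun_prop)
    exact hg.comp (by fun_prop) fun p hp => hsub ⟨hKD hp.1, hp.2⟩
  obtain ⟨C, hC⟩ := (hK.prod isCompact_Icc).exists_bound_of_continuousOn hcont
  have hnh : K ∈ nhds s₀ := mem_interior_iff_mem_nhds.1 hKn
  unfold Sc
  refine (intervalIntegral.hasDerivAt_integral_of_dominated_loc_of_deriv_le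
    (F := fun s t => ψ t * f (c s, t)) (F' := fun s t => ψ t * g (c s, t))
    (bound := fun _ => C) hnh ?_ (Sc_int hL hsub hψ hf hs₀) ?_ ?_ ?_ ?_).2
  · filter_upwards [hnh] with s hs
    exact (Sc_int hL hsub hψ hf (hKD hs)).aestronglyMeasurable_restrict_uIoc
  · exact (Sc_int hL hsub hψ hg hs₀).aestronglyMeasurable_restrict_uIoc
  · refine Filter.Eventually.of_forall fun t ht s hs => ?_
    rw [Set.uIoc_of_le hle] at ht
    exact hC (s, t) ⟨hs, ht.1.le, ht.2⟩
  · simp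
  · refine Filter.Eventually.of_forall fun t ht s hs => ?_
    rw [Set.uIoc_of_le hle] at ht
    exact (hd s t (hsub ⟨hKD hs, ht.1.le, ht.2⟩)).const_mul _

lemma Sc_pd1 {L : ℝ} (hL : 0 < L) {D : Set (ℝ × ℝ)} (hD : IsOpen D) {O : Set ((ℝ × ℝ) × ℝ)}
    (hO : IsOpen O) (hsub : D ×ˢ Set.Icc (-L) L ⊆ O) {ψ : ℝ → ℂ} (hψ : Continuous ψ)
    {f : (ℝ × ℝ) × ℝ → ℂ} (hf : ContDiffOn ℝ 1 f O) {x' : ℝ × ℝ} (hx : x' ∈ D) :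
    pd1 (Sc L ψ f) x' = Sc L ψ (qd1 f) x' := by
  refine (Sc_diff hL hD hsub hψ hf.continuousOn ((isDir1 hO).cont hO hf)
    (c := fun s => (s, x'.2)) (by fun_prop) hx ?_).deriv
  intro s t hst
  rw [isDir1 hO f hf _ hst]
  exact aux_has1 hO hf hst

lemma Sc_pd2 {L : ℝ} (hL : 0 < L) {D : Set (ℝ × ℝ)} (hD : IsOpen D) {O : Set ((ℝ × ℝ) × ℝ)}
    (hO : IsOpen O) (hsub : D ×ˢ Set.Icc (-L) L ⊆ O) {ψ : ℝ → ℂ} (hψ : Continuous ψ)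
    {f : (ℝ × ℝ) × ℝ → ℂ} (hf : ContDiffOn ℝ 1 f O) {x' : ℝ × ℝ} (hx : x' ∈ D) :
    pd2 (Sc L ψ f) x' = Sc L ψ (qd2 f) x' := by
  refine (Sc_diff hL hD hsub hψ hf.continuousOn ((isDir2 hO).cont hO hf)
    (c := fun s => (x'.1, s)) (by fun_prop) hx ?_).deriv
  intro s t hst
  rw [isDir2 hO f hf _ hst]
  exact aux_has2 hO hf hst

lemma pd1_congr {D : Set (ℝ × ℝ)} (hD : IsOpen D) {f g : ℝ × ℝ → ℂ} (h : Set.EqOn f g D) :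
    Set.EqOn (pd1 f) (pd1 g) D := by
  intro x hx
  apply Filter.EventuallyEq.deriv_eq
  have hc : Continuous fun t : ℝ => (t, x.2) := by fun_prop
  filter_upwards [(hD.preimage hc).mem_nhds (show x.1 ∈ _ from hx)] with t ht using h ht

lemma pd2_congr {D : Set (ℝ × ℝ)} (hD : IsOpen D) {f g : ℝ × ℝ → ℂ} (h : Set.EqOn f g D) :
    Set.EqOn (pd2 f) (pd2 g) D := by
  intro x hx
  apply Filter.EventuallyEq.deriv_eq
  have hc : Continuous fun t : ℝ => (x.1, t) := by fun_prop
  filter_upwards [(hD.preimage hc).mem_nhds (show x.2 ∈ _ from hx)] with t ht using h ht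

/-- The weight `e^{-i t ξ} χ(t)`. -/
def wt (ξ : ℝ) (χ : ℝ → ℝ) (t : ℝ) : ℂ :=
  Complex.exp (-Complex.I * (t : ℂ) * (ξ : ℂ)) * (χ t : ℂ)

lemma wt_cont (ξ : ℝ) {χ : ℝ → ℝ} (h : Continuous χ) : Continuous (wt ξ χ) := by
  unfold wt; fun_prop

lemma Sc_ibp {L : ℝ} (hL : 0 < L) {D : Set (ℝ × ℝ)} {O : Set ((ℝ × ℝ) × ℝ)}
    (hO : IsOpen O) (hsub : D ×ˢ Set.Icc (-L) L ⊆ O) (ξ : ℝ) {χ : ℝ → ℝ} (hχ : ContDiff ℝ 1 χ)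
    (h1 : χ L = 0) (h2 : χ (-L) = 0)
    {f : (ℝ × ℝ) × ℝ → ℂ} (hf : ContDiffOn ℝ 1 f O) {x' : ℝ × ℝ} (hx : x' ∈ D) :
    Sc L (wt ξ χ) (qd3 f) x'
      = - Sc L (wt ξ (deriv χ)) f x' + Complex.I * ξ * Sc L (wt ξ χ) f x' := by
  have hle : -L ≤ L := by linarith
  have hc' : Continuous (deriv χ) := hχ.continuous_deriv (by norm_num)
  have hder : ∀ t, HasDerivAt (wt ξ χ) (wt ξ (deriv χ) t - Complex.I * ξ * wt ξ χ t) t := by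
    intro t
    have a1 : HasDerivAt (fun t : ℝ => -Complex.I * (t : ℂ) * (ξ : ℂ)) (-Complex.I * 1 * ξ) t :=
      ((HasDerivAt.ofReal_comp (hasDerivAt_id t)).const_mul _).mul_const _
    have a2 : HasDerivAt (fun t : ℝ => (χ t : ℂ)) (Complex.ofReal (deriv χ t)) t :=
      (hχ.differentiable (by norm_num) t).hasDerivAt.ofReal_comp
    refine (a1.cexp.mul a2).congr_deriv ?_
    unfold wt
    ring
  have key := intervalIntegral.integral_mul_deriv_eq_deriv_mul (a := -L) (b := L)
    (u := wt ξ χ) (v := fun t => f (x', t)) (v' := fun t => qd3 f (x', t))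
    (fun t _ => hder t) (fun t ht => ?_) ?_ ?_
  · have z1 : wt ξ χ L = 0 := by simp [wt, h1]
    have z2 : wt ξ χ (-L) = 0 := by simp [wt, h2]
    unfold Sc
    have i1 := Sc_int hL hsub (wt_cont ξ hc') hf.continuousOn hx
    have i2 := (Sc_int hL hsub (wt_cont ξ hχ.continuous) hf.continuousOn hx).const_mul
      (Complex.I * ξ)
    have e := intervalIntegral.integral_sub i1 i2
    rw [intervalIntegral.integral_const_mul] at e
    rw [key, z1, z2, zero_mul, zero_mul, sub_zero, zero_sub, neg_add_eq_sub, ← neg_sub, ← e]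
    congr 2; ext t; ring
  · rw [Set.uIcc_of_le hle] at ht
    have hm := hsub (show (x', t) ∈ D ×ˢ Set.Icc (-L) L from ⟨hx, ht⟩)
    rw [isDir3 hO f hf _ hm]
    exact aux_has3 hO hf hm
  · apply Continuous.intervalIntegrable
    have := wt_cont ξ hc'
    have := wt_cont ξ hχ.continuous
    fun_prop
  · apply ContinuousOn.intervalIntegrable
    rw [Set.uIcc_of_le hle]
    exact slice_cont hsub ((isDir3 hO).cont hO hf) hx

lemma Sc_add {L : ℝ} (hL : 0 < L) {D : Set (ℝ × ℝ)} {O : Set ((ℝ × ℝ) × ℝ)}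
    (hsub : D ×ˢ Set.Icc (-L) L ⊆ O) {ψ : ℝ → ℂ} (hψ : Continuous ψ)
    {f g : (ℝ × ℝ) × ℝ → ℂ} (hf : ContinuousOn f O) (hg : ContinuousOn g O)
    {x' : ℝ × ℝ} (hx : x' ∈ D) :
    Sc L ψ (fun y => f y + g y) x' = Sc L ψ f x' + Sc L ψ g x' := by
  unfold Sc
  rw [← intervalIntegral.integral_add (Sc_int hL hsub hψ hf hx) (Sc_int hL hsub hψ hg hx)]
  simp only [mul_add]

lemma Sc_mul (L : ℝ) (ψ : ℝ → ℂ) (c : ℂ) (f : (ℝ × ℝ) × ℝ → ℂ) (x' : ℝ × ℝ) :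
    Sc L ψ (fun y => c * f y) x' = c * Sc L ψ f x' := by
  unfold Sc
  rw [← intervalIntegral.integral_const_mul]
  congr 1; ext t; ring

lemma Sc_congr {L : ℝ} (hL : 0 < L) {D : Set (ℝ × ℝ)} {O : Set ((ℝ × ℝ) × ℝ)}
    (hsub : D ×ˢ Set.Icc (-L) L ⊆ O) {ψ : ℝ → ℂ}
    {f g : (ℝ × ℝ) × ℝ → ℂ} (h : Set.EqOn f g O) {x' : ℝ × ℝ} (hx : x' ∈ D) :
    Sc L ψ f x' = Sc L ψ g x' := by
  unfold Sc
  apply intervalIntegral.integral_congr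
  intro t ht
  rw [Set.uIcc_of_le (by linarith)] at ht
  simp only [h (hsub ⟨hx, ht⟩ : (x', t) ∈ O)]

lemma vec_int {L : ℝ} (hL : 0 < L) {D : Set (ℝ × ℝ)} {O : Set ((ℝ × ℝ) × ℝ)}
    (hsub : D ×ˢ Set.Icc (-L) L ⊆ O) {ψ : ℝ → ℂ} (hψ : Continuous ψ)
    {g : (ℝ × ℝ) × ℝ → ℂ × ℂ × ℂ} (hg : ContinuousOn g O) {x' : ℝ × ℝ} (hx : x' ∈ D) :
    (∫ t in (-L)..L, ψ t • g (x', t)) = (Sc L ψ (fun y => (g y).1) x',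
      Sc L ψ (fun y => (g y).2.1) x', Sc L ψ (fun y => (g y).2.2) x') := by
  have hle : -L ≤ L := by linarith
  have hi : IntervalIntegrable (fun t => ψ t • g (x', t)) volume (-L) L := by
    apply ContinuousOn.intervalIntegrable
    rw [Set.uIcc_of_le hle]
    exact hψ.continuousOn.smul (slice_cont hsub hg hx)
  have e1 := (ContinuousLinearMap.fst ℝ ℂ (ℂ × ℂ)).intervalIntegral_comp_comm hi
  have e2 := ((ContinuousLinearMap.fst ℝ ℂ ℂ).comp
    (ContinuousLinearMap.snd ℝ ℂ (ℂ × ℂ))).intervalIntegral_comp_comm hi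
  have e3 := ((ContinuousLinearMap.snd ℝ ℂ ℂ).comp
    (ContinuousLinearMap.snd ℝ ℂ (ℂ × ℂ))).intervalIntegral_comp_comm hi
  exact Prod.ext e1.symm (Prod.ext e2.symm e3.symm)

lemma Sc_lame {L : ℝ} (hL : 0 < L) {D : Set (ℝ × ℝ)} {O : Set ((ℝ × ℝ) × ℝ)}
    (hsub : D ×ˢ Set.Icc (-L) L ⊆ O) {ψ : ℝ → ℂ} (hψ : Continuous ψ) (a b : ℂ)
    {f1 f2 f3 g g1 g2 g3 : (ℝ × ℝ) × ℝ → ℂ} (h1 : ContinuousOn f1 O) (h2 : ContinuousOn f2 O)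
    (h3 : ContinuousOn f3 O) (k1 : ContinuousOn g1 O) (k2 : ContinuousOn g2 O)
    (k3 : ContinuousOn g3 O) (hg : ∀ x ∈ O, g x = g1 x + g2 x + g3 x)
    {x' : ℝ × ℝ} (hx : x' ∈ D) :
    Sc L ψ (fun y => a * (f1 y + f2 y + f3 y) + b * g y) x'
      = a * (Sc L ψ f1 x' + Sc L ψ f2 x' + Sc L ψ f3 x')
        + b * (Sc L ψ g1 x' + Sc L ψ g2 x' + Sc L ψ g3 x') := by
  have hgc : ContinuousOn g O := ((k1.add k2).add k3).congr hg
  rw [Sc_add hL hsub hψ (f := fun y => a * (f1 y + f2 y + f3 y)) (g := fun y => b * g y)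
    (continuousOn_const.mul ((h1.add h2).add h3)) (continuousOn_const.mul hgc) hx,
    Sc_mul, Sc_mul, Sc_congr hL hsub (g := fun y => g1 y + g2 y + g3 y) hg hx,
    Sc_add hL hsub hψ (f := fun y => f1 y + f2 y) (h1.add h2) h3 hx, Sc_add hL hsub hψ h1 h2 hx,
    Sc_add hL hsub hψ (f := fun y => g1 y + g2 y) (k1.add k2) k3 hx, Sc_add hL hsub hψ k1 k2 hx]

theorem stmt_12 (lam mu L : ℝ) (hL : 0 < L) (D : Set (ℝ × ℝ)) (hD : IsOpen D)
    (u : (ℝ × ℝ) × ℝ → ℂ × ℂ × ℂ) (O : Set ((ℝ × ℝ) × ℝ)) (hO : IsOpen O)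
    (hsub : D ×ˢ Set.Icc (-L) L ⊆ O) (hu : ContDiffOn ℝ 2 u O)
    (φ : ℝ → ℝ) (hφ : ContDiff ℝ (⊤ : ℕ∞) φ) (hφsupp : tsupport φ ⊆ Set.Ioo (-L) L) (ξ : ℝ) :
    ∀ x' ∈ D,
      LameRed lam mu (Rxi L ξ φ u) x'
        = Rxi L ξ φ (Lame3 lam mu u) x'
          + (-(∫ t in (-L)..L,
                (Complex.exp (-Complex.I * (t : ℂ) * (ξ : ℂ)) * (Complex.ofReal (deriv (deriv φ) t))) •
                  Mop lam mu u (x', t))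
             + (2 * Complex.I * (ξ : ℂ)) •
                (∫ t in (-L)..L,
                  (Complex.exp (-Complex.I * (t : ℂ) * (ξ : ℂ)) * (Complex.ofReal (deriv φ t))) •
                    Mop lam mu u (x', t))
             + ((ξ : ℂ) ^ 2) • Rxi L ξ φ (Mop lam mu u) x')
          + ((-Complex.I * (ξ : ℂ) * ((lam : ℂ) + (mu : ℂ))) • Rxi L ξ φ (wop u) x'
             + ((lam : ℂ) + (mu : ℂ)) •
                (∫ t in (-L)..L,
                  (Complex.exp (-Complex.I * (t : ℂ) * (ξ : ℂ)) * (Complex.ofReal (deriv φ t))) •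
                    wop u (x', t))) := by
  intro x' hx
  have h1 : ContDiffOn ℝ 2 (fun y => (u y).1) O := contDiff_fst.comp_contDiffOn hu
  have h2 : ContDiffOn ℝ 2 (fun y => (u y).2.1) O :=
    (contDiff_fst.comp contDiff_snd).comp_contDiffOn hu
  have h3 : ContDiffOn ℝ 2 (fun y => (u y).2.2) O :=
    (contDiff_snd.comp contDiff_snd).comp_contDiffOn hu
  set u1 := fun y => (u y).1 with hu1
  set u2 := fun y => (u y).2.1 with hu2
  set u3 := fun y => (u y).2.2 with hu3
  have d1 := isDir1 hO
  have d2 := isDir2 hO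
  have d3 := isDir3 hO
  have lo : ∀ {f : (ℝ × ℝ) × ℝ → ℂ}, ContDiffOn ℝ 2 f O → ContDiffOn ℝ 1 f O :=
    fun hf => hf.of_le (by norm_num)
  have cc : ∀ {Q Q' : ((ℝ × ℝ) × ℝ → ℂ) → (ℝ × ℝ) × ℝ → ℂ} {v v'}, IsDir O Q v → IsDir O Q' v' →
      ∀ {f : (ℝ × ℝ) × ℝ → ℂ}, ContDiffOn ℝ 2 f O → ContinuousOn (Q (Q' f)) O :=
    fun hQ hQ' _ hf => hQ.cont hO (hQ'.smooth1 hO hf)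
  have hφ0 : Continuous φ := hφ.continuous
  have hφ2 : ContDiff ℝ 2 φ := contDiff_infty.1 hφ 2
  have hφ1 : ContDiff ℝ 1 φ := hφ2.of_le (by norm_num)
  have hφ' : ContDiff ℝ 1 (deriv φ) := by
    have : ContDiff ℝ (1 + 1) φ := hφ2.of_le (by norm_num)
    exact (contDiff_succ_iff_deriv.1 this).2.2
  have hφ'' : Continuous (deriv (deriv φ)) := hφ'.continuous_deriv (by norm_num)
  have ev : ∀ s : ℝ, s ∉ Set.Ioo (-L) L → φ s = 0 ∧ deriv φ s = 0 := by
    intro s hs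
    refine ⟨image_eq_zero_of_notMem_tsupport fun h => hs (hφsupp h), ?_⟩
    by_contra h
    exact hs (hφsupp (support_deriv_subset h))
  have eL := ev L (by simp)
  have eL' := ev (-L) (by simp)
  have w0 := wt_cont ξ hφ0
  have w1 := wt_cont ξ hφ'.continuous
  have w2 := wt_cont ξ hφ''
  have hR : ∀ y ∈ D, Rxi L ξ φ u y = (Sc L (wt ξ φ) u1 y, Sc L (wt ξ φ) u2 y, Sc L (wt ξ φ) u3 y) :=
    fun y hy => vec_int hL hsub w0 hu.continuousOn hy
  have R1 : Set.EqOn (fun y => (Rxi L ξ φ u y).1) (Sc L (wt ξ φ) u1) D :=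
    fun y hy => by simp only [hR y hy]
  have R2 : Set.EqOn (fun y => (Rxi L ξ φ u y).2.1) (Sc L (wt ξ φ) u2) D :=
    fun y hy => by simp only [hR y hy]
  have R3 : Set.EqOn (fun y => (Rxi L ξ φ u y).2.2) (Sc L (wt ξ φ) u3) D :=
    fun y hy => by simp only [hR y hy]
  have p11 : ∀ {F f}, ContDiffOn ℝ 2 f O → Set.EqOn F (Sc L (wt ξ φ) f) D →
      pd1 (pd1 F) x' = Sc L (wt ξ φ) (qd1 (qd1 f)) x' := fun {F f} hf hF => by
    rw [pd1_congr hD ((pd1_congr hD hF).trans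
      (fun y hy => Sc_pd1 hL hD hO hsub w0 (lo hf) hy)) hx]
    exact Sc_pd1 hL hD hO hsub w0 (d1.smooth1 hO hf) hx
  have p22 : ∀ {F f}, ContDiffOn ℝ 2 f O → Set.EqOn F (Sc L (wt ξ φ) f) D →
      pd2 (pd2 F) x' = Sc L (wt ξ φ) (qd2 (qd2 f)) x' := fun {F f} hf hF => by
    rw [pd2_congr hD ((pd2_congr hD hF).trans
      (fun y hy => Sc_pd2 hL hD hO hsub w0 (lo hf) hy)) hx]
    exact Sc_pd2 hL hD hO hsub w0 (d2.smooth1 hO hf) hx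
  have p12 : ∀ {F f}, ContDiffOn ℝ 2 f O → Set.EqOn F (Sc L (wt ξ φ) f) D →
      pd1 (pd2 F) x' = Sc L (wt ξ φ) (qd1 (qd2 f)) x' := fun {F f} hf hF => by
    rw [pd1_congr hD ((pd2_congr hD hF).trans
      (fun y hy => Sc_pd2 hL hD hO hsub w0 (lo hf) hy)) hx]
    exact Sc_pd1 hL hD hO hsub w0 (d2.smooth1 hO hf) hx
  -- second derivatives in `x₃`
  have i1 : ∀ {f}, ContDiffOn ℝ 1 f O → Sc L (wt ξ φ) (qd3 f) x'
      = - Sc L (wt ξ (deriv φ)) f x' + Complex.I * ξ * Sc L (wt ξ φ) f x' :=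
    fun hf => Sc_ibp hL hO hsub ξ hφ1 eL.1 eL'.1 hf hx
  have i2 : ∀ {f}, ContDiffOn ℝ 1 f O → Sc L (wt ξ (deriv φ)) (qd3 f) x'
      = - Sc L (wt ξ (deriv (deriv φ))) f x' + Complex.I * ξ * Sc L (wt ξ (deriv φ)) f x' :=
    fun hf => Sc_ibp hL hO hsub ξ hφ' eL.2 eL'.2 hf hx
  have i33 : ∀ {f}, ContDiffOn ℝ 2 f O → Sc L (wt ξ φ) (qd3 (qd3 f)) x'
      = Sc L (wt ξ (deriv (deriv φ))) f x' - 2 * Complex.I * ξ * Sc L (wt ξ (deriv φ)) f x'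
        - ξ ^ 2 * Sc L (wt ξ φ) f x' := fun {f} hf => by
    rw [i1 (d3.smooth1 hO hf), i1 (lo hf), i2 (lo hf)]
    linear_combination (ξ ^ 2 * Sc L (wt ξ φ) f x') * Complex.I_sq
  have hdiv : ∀ {Q v}, IsDir O Q v → ∀ x ∈ O,
      Q (div3 u) x = Q (qd1 u1) x + Q (qd2 u2) x + Q (qd3 u3) x := fun {Q v} hQ x hxO => by
    have a1 := d1.smooth1 hO h1
    have a2 := d2.smooth1 hO h2
    have a3 := d3.smooth1 hO h3
    rw [← hQ.add hO a1 a2 hxO, ← hQ.add hO (a1.add a2) a3 hxO]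
    rfl
  have hdc : ∀ {Q v}, IsDir O Q v → ContinuousOn (Q (div3 u)) O := fun {Q v} hQ =>
    (((cc hQ d1 h1).add (cc hQ d2 h2)).add (cc hQ d3 h3)).congr (hdiv hQ)
  have lc : ContinuousOn (Lame3 lam mu u) O := by
    refine ContinuousOn.prodMk ?_ (ContinuousOn.prodMk ?_ ?_)
    · exact (continuousOn_const.mul (((cc d1 d1 h1).add (cc d2 d2 h1)).add (cc d3 d3 h1))).add
        (continuousOn_const.mul (hdc d1))
    · exact (continuousOn_const.mul (((cc d1 d1 h2).add (cc d2 d2 h2)).add (cc d3 d3 h2))).add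
        (continuousOn_const.mul (hdc d2))
    · exact (continuousOn_const.mul (((cc d1 d1 h3).add (cc d2 d2 h3)).add (cc d3 d3 h3))).add
        (continuousOn_const.mul (hdc d3))
  have mc : ContinuousOn (Mop lam mu u) O :=
    (continuousOn_const.mul h1.continuousOn).prodMk
      ((continuousOn_const.mul h2.continuousOn).prodMk (continuousOn_const.mul h3.continuousOn))
  have wc : ContinuousOn (wop u) O :=
    (d1.cont hO (lo h3)).prodMk ((d2.cont hO (lo h3)).prodMk
      ((d1.cont hO (lo h1)).add (d2.cont hO (lo h2))))
  have VM : ∀ {χ : ℝ → ℝ}, Continuous χ →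
      (∫ t in (-L)..L, (Complex.exp (-Complex.I * (t : ℂ) * (ξ : ℂ)) * (Complex.ofReal (χ t))) •
        Mop lam mu u (x', t)) = ((lam : ℂ) * Sc L (wt ξ χ) u1 x', (lam : ℂ) * Sc L (wt ξ χ) u2 x',
          ((2 * lam + mu : ℝ) : ℂ) * Sc L (wt ξ χ) u3 x') := fun {χ} hχ => by
    rw [← Sc_mul, ← Sc_mul, ← Sc_mul]
    exact vec_int hL hsub (wt_cont ξ hχ) mc hx
  have VW : ∀ {χ : ℝ → ℝ}, Continuous χ →
      (∫ t in (-L)..L, (Complex.exp (-Complex.I * (t : ℂ) * (ξ : ℂ)) * (Complex.ofReal (χ t))) •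
        wop u (x', t)) = (Sc L (wt ξ χ) (qd1 u3) x', Sc L (wt ξ χ) (qd2 u3) x',
          Sc L (wt ξ χ) (qd1 u1) x' + Sc L (wt ξ χ) (qd2 u2) x') := fun {χ} hχ => by
    rw [← Sc_add hL hsub (wt_cont ξ hχ) (d1.cont hO (lo h1)) (d2.cont hO (lo h2)) hx]
    exact vec_int hL hsub (wt_cont ξ hχ) wc hx
  have VL : Rxi L ξ φ (Lame3 lam mu u) x' = _ := vec_int hL hsub w0 lc hx
  have L1 := Sc_lame hL hsub w0 lam (lam + mu) (cc d1 d1 h1) (cc d2 d2 h1) (cc d3 d3 h1)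
    (cc d1 d1 h1) (cc d1 d2 h2) (cc d1 d3 h3) (hdiv d1) hx
  have L2 := Sc_lame hL hsub w0 lam (lam + mu) (cc d1 d1 h2) (cc d2 d2 h2) (cc d3 d3 h2)
    (cc d2 d1 h1) (cc d2 d2 h2) (cc d2 d3 h3) (hdiv d2) hx
  have L3 := Sc_lame hL hsub w0 lam (lam + mu) (cc d1 d1 h3) (cc d2 d2 h3) (cc d3 d3 h3)
    (cc d3 d1 h1) (cc d3 d2 h2) (cc d3 d3 h3) (hdiv d3) hx
  have s13 : Sc L (wt ξ φ) (qd1 (qd3 u3)) x' = Sc L (wt ξ φ) (qd3 (qd1 u3)) x' :=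
    Sc_congr hL hsub (fun _ hy => d1.symm hO d3 h3 hy) hx
  have s23 : Sc L (wt ξ φ) (qd2 (qd3 u3)) x' = Sc L (wt ξ φ) (qd3 (qd2 u3)) x' :=
    Sc_congr hL hsub (fun _ hy => d2.symm hO d3 h3 hy) hx
  have s21 : Sc L (wt ξ φ) (qd2 (qd1 u1)) x' = Sc L (wt ξ φ) (qd1 (qd2 u1)) x' :=
    Sc_congr hL hsub (fun _ hy => d2.symm hO d1 h1 hy) hx
  rw [s13, i33 h1, i1 (d1.smooth1 hO h3)] at L1
  rw [s23, s21, i33 h2, i1 (d2.smooth1 hO h3)] at L2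
  rw [i33 h3, i1 (d1.smooth1 hO h1), i1 (d2.smooth1 hO h2)] at L3
  have VL' := VL.trans (Prod.ext L1 (Prod.ext L2 L3) : _ = (_, _, _))
  rw [VL', VM hφ'', VM hφ'.continuous, VW hφ'.continuous,
    show Rxi L ξ φ (Mop lam mu u) x' = _ from VM hφ0,
    show Rxi L ξ φ (wop u) x' = _ from VW hφ0]
  unfold LameRed
  rw [p11 h1 R1, p22 h1 R1, p12 h2 R2, p11 h2 R2, p22 h2 R2, p12 h1 R1, p11 h3 R3, p22 h3 R3]
  simp only [Prod.mk_add_mk, Prod.neg_mk, Prod.smul_mk, smul_eq_mul]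
  push_cast
  refine Prod.ext ?_ (Prod.ext ?_ ?_)
  · ring
  · ring
  · ring
end
end
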